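/- Let A be an Artin algebra, and suppose that every localizing subcategory (i.e., triangulated subcategory closed under arbitrary coproducts) of the Gorenstein-injective derived category D_GI(A) which contains all Gorenstein-injective A-modules (regarded as complexes concentrated in degree 0) is equal to D_GI(A). Then every bounded below GP-acyclic cochain complex of Gorenstein-projective A-modules is contractible. -/

import Mathlib

open CategoryTheory CategoryTheory.Limits

universe u

variable (A : Type u) [Ring A]

/-- The category of cochain complexes of left `A`-modules. -/
abbrev Cplx := CochainComplex (ModuleCat.{u} A) ℤ

/-- A cochain complex is acyclic (exact) if all its cohomology vanishes. -/
def IsAcyclicComplex (X : Cplx A) : Prop := ∀ n : ℤ, X.ExactAt n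

/-- The complex `Hom_A(G, X)` is acyclic. -/
def HomFromAcyclic (G : ModuleCat.{u} A) (X : Cplx A) : Prop :=
  ∀ (n : ℤ) (f : G ⟶ X.X n), f ≫ X.d n (n + 1) = 0 →
    ∃ g : G ⟶ X.X (n - 1), g ≫ X.d (n - 1) n = f

/-- The complex `Hom_A(X, J)` is acyclic. -/
def HomToAcyclic (X : Cplx A) (J : ModuleCat.{u} A) : Prop :=
  ∀ (n : ℤ) (f : X.X n ⟶ J), X.d (n - 1) n ≫ f = 0 →
    ∃ g : X.X (n + 1) ⟶ J, X.d n (n + 1) ≫ g = f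

/-- A Gorenstein-projective module. -/
def IsGorensteinProjective (G : ModuleCat.{u} A) : Prop :=
  ∃ P : Cplx A, IsAcyclicComplex A P ∧ (∀ n : ℤ, Module.Projective A (P.X n)) ∧
    (∀ Q : ModuleCat.{u} A, Module.Projective A Q → HomToAcyclic A P Q) ∧
    Nonempty (G ≅ kernel (P.d 0 1))

/-- A Gorenstein-injective module. -/
def IsGorensteinInjective (J : ModuleCat.{u} A) : Prop :=
  ∃ I : Cplx A, IsAcyclicComplex A I ∧ (∀ n : ℤ, Module.Injective A (I.X n)) ∧
    (∀ E : ModuleCat.{u} A, Module.Injective A E → HomFromAcyclic A E I) ∧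
    Nonempty (J ≅ kernel (I.d 0 1))

/-- A complex `X` is GP-acyclic if `Hom_A(G,X)` is acyclic for every
Gorenstein-projective module `G`. -/
def GPAcyclic (X : Cplx A) : Prop :=
  ∀ G : ModuleCat.{u} A, IsGorensteinProjective A G → HomFromAcyclic A G X

/-- A complex `X` is GI-acyclic if `Hom_A(X,J)` is acyclic for every
Gorenstein-injective module `J`. -/
def GIAcyclic (X : Cplx A) : Prop :=
  ∀ J : ModuleCat.{u} A, IsGorensteinInjective A J → HomToAcyclic A X J

/-- A cochain complex is contractible if its identity is homotopic to zero. -/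
def Contractible (X : Cplx A) : Prop := Nonempty (Homotopy (𝟙 X) 0)

/-- A cochain complex is bounded below if `Xⁿ = 0` for all sufficiently small `n`. -/
def BoundedBelow (X : Cplx A) : Prop := ∃ a : ℤ, ∀ n < a, IsZero (X.X n)

/-- A cochain complex is bounded if `Xⁿ = 0` for all but finitely many `n`. -/
def BoundedComplex (X : Cplx A) : Prop :=
  ∃ a b : ℤ, ∀ n : ℤ, (n < a ∨ b < n) → IsZero (X.X n)

/-- `ProjDimLE n M` means that `M` has projective dimension at most `n`. -/
def ProjDimLE : ℕ → ModuleCat.{u} A → Prop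
  | 0 => fun M => Module.Projective A M
  | n + 1 => fun M => ∃ (K P : ModuleCat.{u} A) (i : K ⟶ P) (p : P ⟶ M),
      Module.Projective A P ∧ Function.Injective i ∧ Function.Surjective p ∧
      Function.Exact i p ∧ ProjDimLE n K

/-- The big finitistic projective dimension of `A` is finite. -/
def FPDFinite : Prop :=
  ∃ s : ℕ, ∀ M : ModuleCat.{u} A, (∃ n : ℕ, ProjDimLE A n M) → ProjDimLE A s M

/-- The homotopy category `K(A)` of cochain complexes of `A`-modules. -/
abbrev KCat := HomotopyCategory (ModuleCat.{u} A) (ComplexShape.up ℤ)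

/-- The class of morphisms of `K(A)` whose cone is GP-acyclic, i.e. the
morphisms inverted in the Verdier quotient `K(A)/K_gpac(A)`. -/
def gpW : MorphismProperty (KCat A) := fun X Y f =>
  ∃ g : X.as ⟶ Y.as, (HomotopyCategory.quotient _ _).map g = f ∧
    GPAcyclic A (CochainComplex.mappingCone g)

/-- The class of morphisms of `K(A)` whose cone is GI-acyclic, i.e. the
morphisms inverted in the Verdier quotient `K(A)/K_giac(A)`. -/
def giW : MorphismProperty (KCat A) := fun X Y f =>
  ∃ g : X.as ⟶ Y.as, (HomotopyCategory.quotient _ _).map g = f ∧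
    GIAcyclic A (CochainComplex.mappingCone g)

/-- The Gorenstein-projective derived category `D_GP(A)`, the Verdier quotient
`K(A)/K_gpac(A)`, realized as the localization of `K(A)` at the morphisms whose
cone is GP-acyclic. -/
noncomputable abbrev DGP := (gpW A).Localization

/-- The quotient functor `K(A) ⥤ D_GP(A)`. -/
noncomputable abbrev DGPQ : KCat A ⥤ DGP A := (gpW A).Q

/-- The Gorenstein-injective derived category `D_GI(A)`, the Verdier quotient
`K(A)/K_giac(A)`, realized as the localization of `K(A)` at the morphisms whose
cone is GI-acyclic. -/
noncomputable abbrev DGI := (giW A).Localization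

/-- The quotient functor `K(A) ⥤ D_GI(A)`. -/
noncomputable abbrev DGIQ : KCat A ⥤ DGI A := (giW A).Q

open Pretriangulated in
/-- The object of `D_GI(A)` determined by a module `M`, regarded as a complex
concentrated in degree `0`. -/
noncomputable def singleDGI (M : ModuleCat.{u} A) : DGI A :=
  (DGIQ A).obj ((HomotopyCategory.quotient _ _).obj
    ((HomologicalComplex.single (ModuleCat.{u} A) (ComplexShape.up ℤ) 0).obj M))

open Pretriangulated in
/-- `S` is a localizing subcategory of `D_GI(A)`: it is closed under
isomorphisms, under shifts, under extensions (images of distinguished triangles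
of `K(A)`, from which the triangulated structure of the Verdier quotient
`D_GI(A)` is induced), and under arbitrary (small) coproducts. -/
def IsLocalizingSubcategory (S : Set (DGI A)) : Prop :=
  (∀ X Y : DGI A, (X ≅ Y) → X ∈ S → Y ∈ S) ∧
  (∀ X : KCat A, (DGIQ A).obj X ∈ S ↔ (DGIQ A).obj (X⟦(1 : ℤ)⟧) ∈ S) ∧
  (∀ T : Triangle (KCat A), T ∈ distinguishedTriangles →
    (DGIQ A).obj T.obj₁ ∈ S → (DGIQ A).obj T.obj₂ ∈ S → (DGIQ A).obj T.obj₃ ∈ S) ∧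
  (∀ (I : Type u) (X : I → DGI A) (c : Cofan X), IsColimit c →
    (∀ i : I, X i ∈ S) → c.pt ∈ S)

section P1
open CochainComplex CochainComplex.HomComplex Preadditive

variable {A}

lemma homTo_gen {Z : Cplx A} {J : ModuleCat.{u} A} (h : HomToAcyclic A Z J)
    (i j l : ℤ) (hij : i + 1 = j) (hjl : j + 1 = l) (f : Z.X j ⟶ J) (hf : Z.d i j ≫ f = 0) :
    ∃ g : Z.X l ⟶ J, Z.d j l ≫ g = f := by
  subst hjl
  obtain rfl : i = j - 1 := by lia
  exact h j f hf

lemma homFrom_gen {Z : Cplx A} {J : ModuleCat.{u} A} (h : HomFromAcyclic A J Z)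
    (i j l : ℤ) (hij : i + 1 = j) (hjl : j + 1 = l) (f : J ⟶ Z.X j) (hf : f ≫ Z.d j l = 0) :
    ∃ g : J ⟶ Z.X i, g ≫ Z.d i j = f := by
  subst hjl
  obtain rfl : i = j - 1 := by lia
  exact h j f hf

lemma giac_aux {K L : Cplx A}
    (f : K ⟶ L) (α : Cochain K L (-1)) (n m : ℤ) (hnm : n + 1 = m)
    (hK : HomToAcyclic A K (L.X m))
    (hα : (δ (-1) 0 α).EqUpTo (Cochain.ofHom f) n) :
    ∃ (h : K.X (n + 2) ⟶ L.X (n + 1)),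
      (δ (-1) 0 (α + Cochain.single h (-1))).EqUpTo (Cochain.ofHom f) m := by
  subst hnm
  let u := f.f (n + 1) - α.v (n + 1) n (by lia) ≫ L.d n (n + 1) -
    K.d (n + 1) (n + 2) ≫ α.v (n + 2) (n + 1) (by lia)
  have hu : K.d n (n + 1) ≫ u = 0 := by
    have eq := hα n n (add_zero n) (by rfl)
    simp only [δ_v (-1) 0 (neg_add_cancel 1) α n n (add_zero _) (n - 1) (n + 1)
      (by lia) (by lia), Int.negOnePow_zero, one_smul, Cochain.ofHom_v] at eq
    simp only [u, comp_sub, HomologicalComplex.d_comp_d_assoc, zero_comp,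
      ← f.comm, ← eq, add_comp, Category.assoc, L.d_comp_d, comp_zero, zero_add, sub_self]
  obtain ⟨β, hβ⟩ : ∃ (β : K.X (n + 2) ⟶ L.X (n + 1)), K.d (n + 1) (n + 2) ≫ β = u :=
    homTo_gen hK n (n+1) (n+2) rfl (by lia) u hu
  refine ⟨β, ?_⟩
  intro p q hpq hp
  obtain rfl : p = q := by lia
  obtain hp | rfl := hp.lt_or_eq
  · rw [δ_add, Cochain.add_v, hα p p (by lia) (by lia), add_eq_left,
      δ_v (-1) 0 (neg_add_cancel 1) _ p p hpq (p - 1) (p + 1) rfl rfl,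
      Cochain.single_v_eq_zero _ _ _ _ _ (by lia),
      Cochain.single_v_eq_zero _ _ _ _ _ (by lia)]
    simp
  · rw [δ_v (-1) 0 (neg_add_cancel 1) _ (n + 1) (n + 1) (by lia) n (n + 2)
      (by lia) (by lia), Cochain.add_v,
      Cochain.single_v_eq_zero _ _ _ _ _ (by lia)]
    simp [hβ, u]

open Cochain.InductionUp in
lemma giac_null {K L : Cplx A} (hL : BoundedBelow A L)
    (hK : ∀ n, HomToAcyclic A K (L.X n)) (f : K ⟶ L) : Nonempty (Homotopy f 0) := by
    obtain ⟨d, hd⟩ := hL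
    let X (n : ℕ) : Set (Cochain K L (-1)) :=
      Set.ofPred (fun α => (δ (-1) 0 α).EqUpTo (Cochain.ofHom f) (n + d - 1))
    let x₀ : X 0 := ⟨0, fun p q hpq hp ↦
      IsZero.eq_of_tgt (hd _ (by lia)) _ _⟩
    let φ (n : ℕ) (α : X n) : X (n + 1) :=
      ⟨_, (giac_aux f α.1 (n + d - 1) ((n + 1 : ℕ) + d - 1)
        (by lia) (hK _) α.2).choose_spec⟩
    have hφ (k : ℕ) (x : X k) : (φ k x).1.EqUpTo x.1 (d + k) := fun p q hpq hp => by
      dsimp [φ]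
      rw [add_eq_left, Cochain.single_v_eq_zero _ _ _ _ _ (by lia)]
    refine ⟨(Cochain.equivHomotopy f 0).symm ⟨limitSequence φ hφ x₀, ?_⟩⟩
    rw [Cochain.ofHom_zero, add_zero]
    ext n : 1
    let k₀ := (n - d + 1).toNat
    rw [← (sequence φ x₀ k₀).2 n n (add_zero n) (by lia),
      δ_v (-1) 0 (neg_add_cancel 1) _ n n (by lia) (n - 1) (n + 1) rfl (by lia),
      δ_v (-1) 0 (neg_add_cancel 1) _ n n (by lia) (n - 1) (n + 1) rfl (by lia),
      limitSequence_eqUpTo φ hφ x₀ k₀ n (n - 1) (by lia) (by lia),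
      limitSequence_eqUpTo φ hφ x₀ k₀ (n + 1) n (by lia) (by lia)]

lemma bb_shift {L : Cplx A} (hL : BoundedBelow A L) (n : ℤ) : BoundedBelow A (L⟦n⟧) := by
  obtain ⟨a, ha⟩ := hL
  exact ⟨a - n, fun i hi => ha (i + n) (by lia)⟩

lemma homTo_shift {Z : Cplx A} {J : ModuleCat.{u} A} (h : HomToAcyclic A Z J) (n : ℤ) :
    HomToAcyclic A (Z⟦n⟧) J := by
  intro i (f : Z.X (i + n) ⟶ J) hf
  replace hf : (n.negOnePow • Z.d (i - 1 + n) (i + n)) ≫ f = 0 := hf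
  change ∃ g : Z.X (i + 1 + n) ⟶ J, (n.negOnePow • Z.d (i + n) (i + 1 + n)) ≫ g = f
  rcases Int.units_eq_one_or n.negOnePow with hn | hn <;> rw [hn] at hf ⊢
  · simp only [one_smul] at hf ⊢
    exact homTo_gen h _ (i + n) (i + 1 + n) (by lia) (by lia) f hf
  · simp only [Units.neg_smul, one_smul, neg_comp, neg_eq_zero] at hf ⊢
    obtain ⟨g, hg⟩ := homTo_gen h _ (i + n) (i + 1 + n) (by lia) (by lia) f hf
    exact ⟨-g, by simp [hg]⟩

lemma homFrom_shift {Z : Cplx A} {J : ModuleCat.{u} A} (h : HomFromAcyclic A J Z) (n : ℤ) :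
    HomFromAcyclic A J (Z⟦n⟧) := by
  intro i (f : J ⟶ Z.X (i + n)) hf
  replace hf : f ≫ (n.negOnePow • Z.d (i + n) (i + 1 + n)) = 0 := hf
  change ∃ g : J ⟶ Z.X (i - 1 + n), g ≫ (n.negOnePow • Z.d (i - 1 + n) (i + n)) = f
  rcases Int.units_eq_one_or n.negOnePow with hn | hn <;> rw [hn] at hf ⊢
  · simp only [one_smul] at hf ⊢
    exact homFrom_gen h _ (i + n) (i + 1 + n) (by lia) (by lia) f hf
  · simp only [Units.neg_smul, one_smul, comp_neg, neg_eq_zero] at hf ⊢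
    obtain ⟨g, hg⟩ := homFrom_gen h (i - 1 + n) (i + n) (i + 1 + n) (by lia) (by lia) f hf
    exact ⟨-g, by simp [hg]⟩

lemma single_null {J : ModuleCat.{u} A} {L : Cplx A} (h : HomFromAcyclic A J L)
    (f : (HomologicalComplex.single (ModuleCat.{u} A) (ComplexShape.up ℤ) 0).obj J ⟶ L) :
    Nonempty (Homotopy f 0) := by
  let e := HomologicalComplex.singleObjXSelf (ComplexShape.up ℤ) 0 J
  have h0 : (e.inv ≫ f.f 0) ≫ L.d 0 1 = 0 := by
    rw [Category.assoc, f.comm, HomologicalComplex.single_obj_d]; simp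
  obtain ⟨g, hg⟩ := homFrom_gen h (-1) 0 1 (by lia) (by lia) _ h0
  let α : Cochain ((HomologicalComplex.single (ModuleCat.{u} A) (ComplexShape.up ℤ) 0).obj J) L (-1) :=
    Cochain.single (e.hom ≫ g) (-1)
  refine ⟨(Cochain.equivHomotopy f 0).symm ⟨α, ?_⟩⟩
  rw [Cochain.ofHom_zero, add_zero]
  ext n : 1
  by_cases hn : n = 0
  · subst hn
    rw [δ_v (-1) 0 (neg_add_cancel 1) _ 0 0 (by lia) (-1) 1 rfl (by lia)]
    simp [α, hg, e]
  · exact IsZero.eq_of_src (HomologicalComplex.isZero_single_obj_X _ _ _ _ hn) _ _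

end P1

section P2
variable {A}

lemma loc_surj {C : Type*} [Category* C] (W : MorphismProperty C) (L : C)
    (hL : ∀ ⦃X Y : C⦄ (w : X ⟶ Y), W w → Function.Bijective (fun g : Y ⟶ L => w ≫ g)) (Y : C) :
    Function.Surjective (fun g : Y ⟶ L => W.Q.map g) := by
  let P : MorphismProperty W.Localization := fun X Y φ =>
    ∀ (y : C) (hy : W.Q.obj y = Y) (g : y ⟶ L), ∃ (x : C) (hx : W.Q.obj x = X) (f : x ⟶ L),
      W.Q.map f = eqToHom hx ≫ φ ≫ eqToHom hy.symm ≫ W.Q.map g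
  have hinj : Function.Injective W.Q.obj := (Localization.Construction.objEquiv W).injective
  have : P.IsStableUnderComposition := ⟨by
    intro X Y Z φ ψ hφ hψ z hz g
    obtain ⟨y, hy, f, hf⟩ := hψ z hz g
    obtain ⟨x, hx, e, he⟩ := hφ y hy f
    exact ⟨x, hx, e, by simp [he, hf]⟩⟩
  have htop : P = ⊤ := by
    apply Localization.Construction.morphismProperty_eq_top
    · intro X Y f y hy g
      obtain rfl := hinj hy
      exact ⟨X, rfl, f ≫ g, by simp⟩
    · intro X Y w hw y hy g
      obtain rfl := hinj hy
      obtain ⟨g', hg'⟩ := (hL w hw).2 g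
      refine ⟨Y, rfl, g', ?_⟩
      dsimp at hg'
      subst hg'
      have := (Localization.Construction.wIso w hw).inv_hom_id
      have h2 : Localization.Construction.wInv w hw ≫ W.Q.map w = 𝟙 _ := this
      simp [reassoc_of% h2]
  intro φ
  have : P φ := by rw [htop]; trivial
  obtain ⟨x, hx, f, hf⟩ := this L rfl (𝟙 _)
  obtain rfl := hinj hx
  exact ⟨f, by simpa using hf⟩

lemma loc_inj {C : Type*} [Category* C] (W : MorphismProperty C) (L : C)
    (hL : ∀ ⦃X Y : C⦄ (w : X ⟶ Y), W w → Function.Bijective (fun g : Y ⟶ L => w ≫ g)) (Y : C) :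
    Function.Injective (fun g : Y ⟶ L => W.Q.map g) := by
  have hF : W.IsInvertedBy (yoneda.obj L).rightOp := by
    intro X Y w hw
    have : IsIso ((yoneda.obj L).map w.op) := by
      rw [isIso_iff_bijective]
      exact hL w hw
    change IsIso ((yoneda.obj L).map w.op).op
    infer_instance
  intro f g hfg
  dsimp at hfg
  have e := Localization.Construction.fac (yoneda.obj L).rightOp hF
  have key : (W.Q ⋙ Localization.Construction.lift _ hF).map f =
    (W.Q ⋙ Localization.Construction.lift _ hF).map g := by simp [hfg]
  rw [e] at key
  have := congr_fun (congrArg (fun t => (t.unop : _ → _)) key) (𝟙 L)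
  simpa using this

lemma quot_map_null {K L : Cplx A} {f : K ⟶ L} (h : Nonempty (Homotopy f 0)) :
    (HomotopyCategory.quotient (ModuleCat.{u} A) (ComplexShape.up ℤ)).map f = 0 := by
  rw [HomotopyCategory.eq_of_homotopy f 0 h.some, Functor.map_zero]

/-- Objects of `K(A)` right orthogonal to all GI-acyclic complexes. -/
def GILocal (L : KCat A) : Prop :=
  ∀ (Z : Cplx A), GIAcyclic A Z → ∀ f : (HomotopyCategory.quotient _ _).obj Z ⟶ L, f = 0

open Pretriangulated in
lemma gilocal_bij {L : KCat A} (hL : GILocal L) ⦃X Y : KCat A⦄ (w : X ⟶ Y) (hw : giW A w) :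
    Function.Bijective (fun g : Y ⟶ L => w ≫ g) := by
  obtain ⟨g, rfl, hg⟩ := hw
  have hT := HomotopyCategory.mappingCone_triangleh_distinguished g
  have h3 : ∀ f : (CochainComplex.mappingCone.triangleh g).obj₃ ⟶ L, f = 0 := fun f => hL _ hg f
  have hm : ∀ f : (CochainComplex.mappingCone.triangleh g).obj₃⟦(-1 : ℤ)⟧ ⟶ L, f = 0 := by
    intro f
    have hs : GIAcyclic A ((CochainComplex.mappingCone g)⟦(-1 : ℤ)⟧) :=
      fun J hJ => homTo_shift (hg J hJ) _
    let e := ((HomotopyCategory.quotient (ModuleCat.{u} A)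
      (ComplexShape.up ℤ)).commShiftIso (-1 : ℤ)).app (CochainComplex.mappingCone g)
    have : e.hom ≫ f = 0 := hL _ hs _
    exact (cancel_epi e.hom).1 (this.trans comp_zero.symm)
  constructor
  · intro a b hab
    dsimp at hab
    obtain ⟨c, hc⟩ := Triangle.yoneda_exact₂ _ hT (a - b)
      ((Preadditive.comp_sub _ _ _ ).trans (sub_eq_zero.2 hab))
    rw [h3 c, comp_zero] at hc
    exact sub_eq_zero.1 hc
  · intro a
    obtain ⟨c, hc⟩ := Triangle.yoneda_exact₂ _ (inv_rot_of_distTriang _ hT) a (hm _)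
    exact ⟨c, hc.symm⟩

lemma gilocal_shift {L : KCat A} (hL : GILocal L) (n : ℤ) : GILocal (L⟦n⟧) := by
  intro Z hZ f
  have hs : GIAcyclic A (Z⟦(-n : ℤ)⟧) := fun J hJ => homTo_shift (hZ J hJ) _
  let e := ((HomotopyCategory.quotient (ModuleCat.{u} A)
      (ComplexShape.up ℤ)).commShiftIso (-n : ℤ)).app Z
  have h1 : e.hom ≫ f⟦(-n : ℤ)⟧' ≫ (shiftShiftNeg L n).hom = 0 := hL _ hs _
  have h2 : f⟦(-n : ℤ)⟧' ≫ (shiftShiftNeg L n).hom = 0 :=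
    (cancel_epi e.hom).1 (h1.trans comp_zero.symm)
  have h3 : f⟦(-n : ℤ)⟧' = 0 := (cancel_mono (shiftShiftNeg L n).hom).1 (h2.trans zero_comp.symm)
  exact (shiftFunctor (KCat A) (-n)).map_injective (h3.trans (Functor.map_zero _ _ _).symm)

open Pretriangulated in
lemma core_contractible
    (hgen : ∀ S : Set (DGI A), IsLocalizingSubcategory A S →
      (∀ M : ModuleCat.{u} A, IsGorensteinInjective A M → singleDGI A M ∈ S) →
      S = Set.univ)
    (L : Cplx A) (hb : BoundedBelow A L) (hGI : ∀ n, IsGorensteinInjective A (L.X n))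
    (hJ : ∀ J, IsGorensteinInjective A J → HomFromAcyclic A J L) :
    Contractible A L := by
  let l : KCat A := (HomotopyCategory.quotient _ _).obj L
  have hl : GILocal l := by
    intro Z hZ f
    obtain ⟨f, rfl⟩ := (HomotopyCategory.quotient _ _).map_surjective f
    exact quot_map_null (giac_null hb (fun n => hZ _ (hGI n)) f)
  have hln (n : ℤ) := gilocal_shift hl n
  let S : Set (DGI A) := {Y | ∀ n : ℤ, Subsingleton (Y ⟶ (DGIQ A).obj (l⟦n⟧))}
  have hS (X : KCat A) : (DGIQ A).obj X ∈ S ↔ ∀ (n : ℤ) (f : X ⟶ l⟦n⟧), f = 0 := by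
    refine forall_congr' fun n => ⟨fun h f => ?_, fun h => ⟨fun a b => ?_⟩⟩
    · exact loc_inj (giW A) _ (gilocal_bij (hln n)) X (Subsingleton.elim _ _)
    · obtain ⟨a, rfl⟩ := loc_surj (giW A) _ (gilocal_bij (hln n)) X a
      obtain ⟨b, rfl⟩ := loc_surj (giW A) _ (gilocal_bij (hln n)) X b
      rw [h a, h b]
  have hloc : IsLocalizingSubcategory A S := by
    refine ⟨?_, ?_, ?_, ?_⟩
    · intro X Y e hX n
      have := hX n
      exact ⟨fun a b => (cancel_epi e.hom).1 (Subsingleton.elim _ _)⟩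
    · intro X
      rw [hS, hS]
      constructor
      · intro h n f
        let e := (shiftFunctorAdd' (KCat A) (n - 1) 1 n (by lia)).app l
        obtain ⟨g, hg⟩ := (shiftFunctor (KCat A) (1 : ℤ)).map_surjective
          (f ≫ e.hom)
        have h1 : f ≫ e.hom = 0 := hg.symm.trans (by rw [h _ g, Functor.map_zero])
        exact (cancel_mono e.hom).1 (h1.trans zero_comp.symm)
      · intro h n f
        let e := (shiftFunctorAdd' (KCat A) n 1 (n + 1) (by lia)).app l
        have h1 : f⟦(1 : ℤ)⟧' ≫ e.inv = 0 := h _ _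
        have h2 : f⟦(1 : ℤ)⟧' = 0 := (cancel_mono e.inv).1 (h1.trans zero_comp.symm)
        exact (shiftFunctor (KCat A) (1 : ℤ)).map_injective (h2.trans (Functor.map_zero _ _ _).symm)
    · intro T hT h1 h2
      rw [hS] at h1 h2 ⊢
      intro n f
      obtain ⟨g, rfl⟩ := Triangle.yoneda_exact₃ T hT f (h2 n _)
      let e := (shiftFunctorAdd' (KCat A) (n - 1) 1 n (by lia)).app l
      obtain ⟨g', hg'⟩ := (shiftFunctor (KCat A) (1 : ℤ)).map_surjective (g ≫ e.hom)
      have h3 : g ≫ e.hom = 0 := hg'.symm.trans (by rw [h1 _ g', Functor.map_zero])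
      have h4 : g = 0 := (cancel_mono e.hom).1 (h3.trans zero_comp.symm)
      rw [h4, comp_zero]
    · intro I X c hc h n
      have := fun i => h i n
      exact ⟨fun a b => Cofan.IsColimit.hom_ext hc _ _ fun i => Subsingleton.elim _ _⟩
  have hmod : ∀ M : ModuleCat.{u} A, IsGorensteinInjective A M → singleDGI A M ∈ S := by
    intro M hM
    refine (hS _).2 fun n f => ?_
    let e := ((HomotopyCategory.quotient (ModuleCat.{u} A)
      (ComplexShape.up ℤ)).commShiftIso n).app L
    obtain ⟨g, hg⟩ := (HomotopyCategory.quotient _ _).map_surjective (f ≫ e.inv)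
    have h1 : f ≫ e.inv = 0 :=
      hg.symm.trans (quot_map_null (single_null (homFrom_shift (hJ M hM) n) g))
    exact (cancel_mono e.inv).1 (h1.trans zero_comp.symm)
  have hu := hgen S hloc hmod
  have hL : (DGIQ A).obj l ∈ S := by rw [hu]; trivial
  have h0 := (hS l).1 hL 0 ((shiftFunctorZero (KCat A) ℤ).inv.app l)
  have h1 : (𝟙 l : l ⟶ l) = 0 := by
    have := (shiftFunctorZero (KCat A) ℤ).inv_hom_id_app l
    rw [h0, zero_comp] at this
    exact this.symm
  refine ⟨HomotopyCategory.homotopyOfEq _ _ ?_⟩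
  rw [CategoryTheory.Functor.map_zero, CategoryTheory.Functor.map_id]
  exact h1

end P2

section P3
variable {A}

lemma exactAt_gen {Y : Cplx A} (n : ℤ)
    (h : kernel.ι (Y.d n (n + 1)) ≫ cokernel.π (Y.d (n - 1) n) = 0) : Y.ExactAt n := by
  rw [Y.exactAt_iff' (n - 1) n (n + 1) (by simp) (by simp)]
  exact (ShortComplex.exact_iff_kernel_ι_comp_cokernel_π_zero _).2 h

lemma acyclic_of_homTo {Y : Cplx A}
    (h : ∀ I : ModuleCat.{u} A, Module.Injective A I → HomToAcyclic A Y I) :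
    IsAcyclicComplex A Y := by
  intro n
  apply exactAt_gen
  have hI : Module.Injective A (Injective.under (cokernel (Y.d (n - 1) n)) : ModuleCat.{u} A) :=
    (Module.injective_iff_injective_object A _).2 (by
      change Injective (Injective.under (cokernel (Y.d (n - 1) n))); infer_instance)
  obtain ⟨g, hg⟩ := h _ hI n (cokernel.π _ ≫ Injective.ι _) (by simp)
  rw [← cancel_mono (Injective.ι _), Category.assoc, ← hg]
  simp

lemma acyclic_of_homFrom {Y : Cplx A}
    (h : ∀ P : ModuleCat.{u} A, Module.Projective A P → HomFromAcyclic A P Y) :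
    IsAcyclicComplex A Y := by
  intro n
  apply exactAt_gen
  have hI : Module.Projective A (Projective.over (kernel (Y.d n (n + 1))) : ModuleCat.{u} A) :=
    (IsProjective.iff_projective _).2 (by
      change Projective (Projective.over (kernel (Y.d n (n + 1)))); infer_instance)
  obtain ⟨g, hg⟩ := h _ hI n (Projective.π _ ≫ kernel.ι _) (by simp)
  rw [← cancel_epi (Projective.π _), ← Category.assoc, ← hg]
  simp

variable {F G : ModuleCat.{u} A ⥤ ModuleCat.{u} A}

/-- applying an additive functor to a complex -/
noncomputable abbrev mapC (F : ModuleCat.{u} A ⥤ ModuleCat.{u} A) [F.Additive] (P : Cplx A) : Cplx A :=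
  (F.mapHomologicalComplex (ComplexShape.up ℤ)).obj P

lemma tr1 (adj : F ⊣ G) [F.Additive] [G.Additive] {P : Cplx A} {I : ModuleCat.{u} A} (h : HomToAcyclic A P (G.obj I)) :
    HomToAcyclic A (mapC F P) I := by
  intro n (f : F.obj (P.X n) ⟶ I) hf
  replace hf : F.map (P.d (n - 1) n) ≫ f = 0 := hf
  obtain ⟨g, hg⟩ := h n (adj.homEquiv _ _ f) (by
    rw [← adj.homEquiv_naturality_left, hf, adj.homEquiv_unit]; simp)
  refine ⟨(adj.homEquiv _ _).symm g, ?_⟩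
  change F.map (P.d n (n + 1)) ≫ _ = f
  rw [← adj.homEquiv_naturality_left_symm, hg, Equiv.symm_apply_apply]

lemma tr2 (adj : F ⊣ G) [F.Additive] [G.Additive] {I : Cplx A} {Q : ModuleCat.{u} A} (h : HomFromAcyclic A (F.obj Q) I) :
    HomFromAcyclic A Q (mapC G I) := by
  intro n (f : Q ⟶ G.obj (I.X n)) hf
  replace hf : f ≫ G.map (I.d n (n + 1)) = 0 := hf
  obtain ⟨g, hg⟩ := h n ((adj.homEquiv _ _).symm f) (by
    rw [← adj.homEquiv_naturality_right_symm, hf, adj.homEquiv_counit]; simp)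
  refine ⟨(adj.homEquiv _ _) g, ?_⟩
  change _ ≫ G.map (I.d (n - 1) n) = f
  rw [← adj.homEquiv_naturality_right, hg, Equiv.apply_symm_apply]

lemma tr3 (adj : F ⊣ G) [F.Additive] [G.Additive] {X : Cplx A} {J : ModuleCat.{u} A} (h : HomFromAcyclic A (G.obj J) X)
    [IsIso (adj.counit.app J)] [∀ n, IsIso (adj.unit.app (X.X n))] :
    HomFromAcyclic A J (mapC F X) := by
  intro n (f : J ⟶ F.obj (X.X n)) hf
  replace hf : f ≫ F.map (X.d n (n + 1)) = 0 := hf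
  have hinv (m : ℤ) : F.map (inv (adj.unit.app (X.X m))) = adj.counit.app (F.obj (X.X m)) := by
    rw [Functor.map_inv, IsIso.inv_eq_of_hom_inv_id]
    exact adj.left_triangle_components _
  have hn : inv (adj.unit.app (X.X n)) ≫ X.d n (n + 1) =
      G.map (F.map (X.d n (n + 1))) ≫ inv (adj.unit.app (X.X (n + 1))) := by
    rw [IsIso.inv_comp_eq, ← Category.assoc, IsIso.eq_comp_inv]
    exact adj.unit.naturality _
  obtain ⟨g, hg⟩ := h n (G.map f ≫ inv (adj.unit.app (X.X n))) (by
    rw [Category.assoc, hn, ← Category.assoc, ← G.map_comp, hf]; simp)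
  have key : inv (adj.counit.app J) ≫ F.map g ≫ F.map (X.d (n - 1) n) = f := by
    rw [← F.map_comp, hg, F.map_comp, hinv, IsIso.inv_comp_eq]
    exact adj.counit.naturality f
  exact ⟨inv (adj.counit.app J) ≫ F.map g, (Category.assoc _ _ _).trans key⟩

lemma tr4 (adj : F ⊣ G) [F.Additive] [G.Additive] {I : Cplx A} {Q : ModuleCat.{u} A} (h : HomToAcyclic A I (F.obj Q))
    [IsIso (adj.unit.app Q)] [∀ n, IsIso (adj.counit.app (I.X n))] :
    HomToAcyclic A (mapC G I) Q := by
  intro n (f : G.obj (I.X n) ⟶ Q) hf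
  replace hf : G.map (I.d (n - 1) n) ≫ f = 0 := hf
  have hinv (m : ℤ) : G.map (inv (adj.counit.app (I.X m))) = adj.unit.app (G.obj (I.X m)) := by
    rw [Functor.map_inv, IsIso.inv_eq_of_inv_hom_id]
    exact adj.right_triangle_components _
  have hn : I.d (n - 1) n ≫ inv (adj.counit.app (I.X n)) =
      inv (adj.counit.app (I.X (n - 1))) ≫ F.map (G.map (I.d (n - 1) n)) := by
    rw [IsIso.eq_inv_comp, ← Category.assoc, IsIso.comp_inv_eq]
    exact (adj.counit.naturality _).symm
  obtain ⟨g, hg⟩ := h n (inv (adj.counit.app (I.X n)) ≫ F.map f) (by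
    rw [← Category.assoc, hn, Category.assoc, ← F.map_comp, hf]; simp)
  have key : (G.map (I.d n (n + 1)) ≫ G.map g) ≫ inv (adj.unit.app Q) = f := by
    rw [← G.map_comp, hg, G.map_comp, hinv, IsIso.comp_inv_eq]
    exact (adj.unit.naturality f).symm
  exact ⟨G.map g ≫ inv (adj.unit.app Q), (Category.assoc _ _ _).symm.trans key⟩

lemma exact_elt {Y : Cplx A} (hY : IsAcyclicComplex A Y) (i j l : ℤ) (hij : i + 1 = j)
    (hjl : j + 1 = l) (x : Y.X j) (hx : Y.d j l x = 0) : ∃ y : Y.X i, Y.d i j y = x := by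
  have := hY j
  rw [Y.exactAt_iff' i j l (by simp; lia) (by simp; lia)] at this
  exact (ShortComplex.moduleCat_exact_iff _).1 this x hx

lemma exists_p {P : Cplx A} (hP : IsAcyclicComplex A P) :
    ∃ p : P.X (-1) ⟶ kernel (P.d 0 1), Epi p ∧ p ≫ kernel.ι _ = P.d (-1) 0 ∧
      P.d (-2) (-1) ≫ p = 0 := by
  have h := hP 0
  rw [P.exactAt_iff' (-1) 0 1 (by simp) (by simp)] at h
  refine ⟨kernel.lift _ (P.d (-1) 0) (by simp), ?_, by simp, ?_⟩
  · exact (ShortComplex.exact_iff_epi_kernel_lift _).1 h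
  · rw [← cancel_mono (kernel.ι _)]; simp

lemma ker_cmp [F.Additive] (hF : F.PreservesEpimorphisms) {P : Cplx A} (hP : IsAcyclicComplex A P)
    (hFP : IsAcyclicComplex A (mapC F P)) :
    IsIso (kernelComparison (P.d 0 1) F) ∧ Mono (F.map (kernel.ι (P.d 0 1))) := by
  obtain ⟨p, hp, hp1, hp2⟩ := exists_p hP
  have hFp : Epi (F.map p) := inferInstance
  have e1 : F.map p ≫ F.map (kernel.ι (P.d 0 1)) = F.map (P.d (-1) 0) := by
    rw [← F.map_comp, hp1]
  have e2 : F.map (P.d (-2) (-1)) ≫ F.map p = 0 := by rw [← F.map_comp, hp2, F.map_zero]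
  have hm : Mono (F.map (kernel.ι (P.d 0 1))) := by
    rw [ModuleCat.mono_iff_injective, injective_iff_map_eq_zero]
    intro y hy
    obtain ⟨z, rfl⟩ := (ModuleCat.epi_iff_surjective _).1 hFp y
    have hz : F.map (P.d (-1) 0) z = 0 := by rw [← e1]; exact hy
    obtain ⟨w, rfl⟩ := exact_elt hFP (-2) (-1) 0 (by lia) (by lia) z hz
    exact congrArg (fun t => t w) e2
  refine ⟨?_, hm⟩
  have hc : kernelComparison (P.d 0 1) F ≫ kernel.ι (F.map (P.d 0 1)) =
    F.map (kernel.ι (P.d 0 1)) := kernelComparison_comp_ι _ _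
  have m1 : Mono (kernelComparison (P.d 0 1) F) := by
    have : Mono (kernelComparison (P.d 0 1) F ≫ kernel.ι (F.map (P.d 0 1))) := by rw [hc]; exact hm
    exact mono_of_mono _ (kernel.ι (F.map (P.d 0 1)))
  have m2 : Epi (kernelComparison (P.d 0 1) F) := by
    rw [ModuleCat.epi_iff_surjective]
    intro y
    have hk : F.map (P.d 0 1) (kernel.ι (F.map (P.d 0 1)) y) = 0 :=
      congrArg (fun t => t y) (kernel.condition (F.map (P.d 0 1)))
    obtain ⟨z, hz⟩ := exact_elt hFP (-1) 0 1 (by lia) (by lia) _ hk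
    refine ⟨F.map p z, ?_⟩
    apply (ModuleCat.mono_iff_injective (kernel.ι (F.map (P.d 0 1)))).1 inferInstance
    rw [← hz]
    have : F.map p ≫ kernelComparison (P.d 0 1) F ≫ kernel.ι (F.map (P.d 0 1)) =
      F.map (P.d (-1) 0) := by rw [hc, e1]
    exact congrArg (fun t => t z) this
  exact isIso_of_mono_of_epi _

lemma isIso_app_of_iso {F G : ModuleCat.{u} A ⥤ ModuleCat.{u} A} (τ : F ⟶ G)
    {X Y : ModuleCat.{u} A} (e : X ≅ Y)
    (h : IsIso (τ.app Y)) : IsIso (τ.app X) := by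
  have : τ.app X = F.map e.hom ≫ τ.app Y ≫ G.map e.inv := by
    rw [← τ.naturality, ← Category.assoc, ← F.map_comp]; simp
  rw [this]
  infer_instance

/-- The properties of a Nakayama adjunction which are used. -/
structure IsNakayama (adj : F ⊣ G) : Prop where
  inj : ∀ P : ModuleCat.{u} A, Module.Projective A P → Module.Injective A (F.obj P)
  proj : ∀ I : ModuleCat.{u} A, Module.Injective A I → Module.Projective A (G.obj I)
  unit : ∀ P : ModuleCat.{u} A, Module.Projective A P → IsIso (adj.unit.app P)
  counit : ∀ I : ModuleCat.{u} A, Module.Injective A I → IsIso (adj.counit.app I)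

variable [F.Additive] [G.Additive] {adj : F ⊣ G}

lemma IsNakayama.mapF (h : IsNakayama adj) {P : Cplx A} (hP : IsAcyclicComplex A P)
    (hpr : ∀ n : ℤ, Module.Projective A (P.X n))
    (ht : ∀ Q : ModuleCat.{u} A, Module.Projective A Q → HomToAcyclic A P Q) :
    IsAcyclicComplex A (mapC F P) ∧ (∀ n : ℤ, Module.Injective A ((mapC F P).X n)) ∧
      (∀ E : ModuleCat.{u} A, Module.Injective A E → HomFromAcyclic A E (mapC F P)) := by
  refine ⟨acyclic_of_homTo fun I hI => tr1 adj (ht _ (h.proj I hI)), fun n => h.inj _ (hpr n),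
    fun E hE => ?_⟩
  have := h.counit E hE
  have := fun n => h.unit _ (hpr n)
  apply tr3 adj
  have hGE := h.proj E hE
  intro n f hf
  have hGE' : Projective (G.obj E) := (IsProjective.iff_projective (G.obj E)).1 hGE
  have hx := hP n
  rw [P.exactAt_iff' (n - 1) n (n + 1) (by simp) (by simp)] at hx
  exact ⟨hx.liftFromProjective f hf, hx.liftFromProjective_comp f hf⟩

lemma IsNakayama.mapG (h : IsNakayama adj) {I : Cplx A} (hI : IsAcyclicComplex A I)
    (hin : ∀ n : ℤ, Module.Injective A (I.X n))
    (ht : ∀ E : ModuleCat.{u} A, Module.Injective A E → HomFromAcyclic A E I) :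
    IsAcyclicComplex A (mapC G I) ∧ (∀ n : ℤ, Module.Projective A ((mapC G I).X n)) ∧
      (∀ Q : ModuleCat.{u} A, Module.Projective A Q → HomToAcyclic A (mapC G I) Q) := by
  refine ⟨acyclic_of_homFrom fun P hP => tr2 adj (ht _ (h.inj P hP)), fun n => h.proj _ (hin n),
    fun Q hQ => ?_⟩
  have := h.unit Q hQ
  have := fun n => h.counit _ (hin n)
  apply tr4 adj
  have hFQ := h.inj Q hQ
  intro n f hf
  have hFQ' : Injective (F.obj Q) := (Module.injective_iff_injective_object A (F.obj Q)).1 hFQ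
  have hx := hI n
  rw [I.exactAt_iff' (n - 1) n (n + 1) (by simp) (by simp)] at hx
  exact ⟨hx.descToInjective f hf, hx.comp_descToInjective f hf⟩


lemma gen_unit {C : Type*} [Category C] [HasZeroMorphisms C] {H : C ⥤ C} (η : 𝟭 C ⟶ H)
    {X Y K : C} {d : X ⟶ Y} {i : K ⟶ X} (w : i ≫ d = 0) (hk : IsLimit (KernelFork.ofι i w))
    (hX : IsIso (η.app X)) (hY : IsIso (η.app Y)) (hm : Mono (H.map i))
    (e3 : H.map i ≫ H.map d = 0) : IsIso (η.app K) := by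
  have hi : Mono i := mono_of_isLimit_fork hk
  have e1 : i ≫ η.app X = η.app K ≫ H.map i := η.naturality i
  have e2 : d ≫ η.app Y = η.app X ≫ H.map d := η.naturality d
  have e4 : (H.map i ≫ inv (η.app X)) ≫ d = 0 := by
    rw [← cancel_mono (η.app Y), Category.assoc, Category.assoc, e2,
      IsIso.inv_hom_id_assoc, e3, zero_comp]
  obtain ⟨l, hl⟩ := KernelFork.IsLimit.lift' hk _ e4
  simp only [Fork.ofι_pt, Fork.ι_ofι] at l hl
  refine ⟨l, ?_, ?_⟩
  · rw [← cancel_mono i, Category.assoc]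
    erw [hl]
    rw [← Category.assoc, ← e1]; simp
  · rw [← cancel_mono (H.map i), Category.assoc, ← e1]
    have := congrArg (· ≫ η.app X) hl
    simp only [Category.assoc, IsIso.inv_hom_id, Category.comp_id] at this
    erw [this]
    simp

lemma gen_counit {C : Type*} [Category C] [Balanced C] {H : C ⥤ C} (ε : H ⟶ 𝟭 C)
    {X Y K : C} {p : Y ⟶ K} {i : K ⟶ X} (hp : Epi p)
    (hX : IsIso (ε.app X)) (hY : IsIso (ε.app Y)) (hm : Mono (H.map i)) : IsIso (ε.app K) := by
  have e1 : H.map i ≫ ε.app X = ε.app K ≫ i := ε.naturality i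
  have e2 : H.map p ≫ ε.app K = ε.app Y ≫ p := ε.naturality p
  have m1 : Mono (ε.app K) := by
    have : Mono (ε.app K ≫ i) := by rw [← e1]; exact mono_comp _ _
    exact mono_of_mono _ i
  have m2 : Epi (ε.app K) := by
    have : Epi (H.map p ≫ ε.app K) := by rw [e2]; exact epi_comp _ _
    exact epi_of_epi (H.map p) _
  exact isIso_of_mono_of_epi _

lemma gen_mono {C D : Type*} [Category C] [Category D] {F : C ⥤ D} {K K' X : C} (e : K ≅ K')
    {i : K ⟶ X} {j : K' ⟶ X} (w : i = e.hom ≫ j) (h : Mono (F.map j)) : Mono (F.map i) := by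
  rw [w, F.map_comp]; exact mono_comp _ _

lemma IsNakayama.gp (h : IsNakayama adj) {X : ModuleCat.{u} A} (hX : IsGorensteinProjective A X) :
    IsGorensteinInjective A (F.obj X) ∧ IsIso (adj.unit.app X) := by
  obtain ⟨P, hP, hpr, ht, ⟨e⟩⟩ := hX
  obtain ⟨h1, h2, h3⟩ := h.mapF hP hpr ht
  have hFe : F.PreservesEpimorphisms := Functor.preservesEpimorphisms_of_adjunction adj
  have hGm : G.PreservesMonomorphisms := Functor.preservesMonomorphisms_of_adjunction adj
  obtain ⟨h4, h5⟩ := ker_cmp (F := F) hFe hP h1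
  refine ⟨⟨mapC F P, h1, h2, h3, ⟨F.mapIso e ≪≫ @asIso _ _ _ _ _ h4⟩⟩, ?_⟩
  refine isIso_app_of_iso adj.unit e ?_
  have hu := fun n => h.unit _ (hpr n)
  refine gen_unit adj.unit (kernel.condition (P.d 0 1)) (kernelIsKernel _) (hu 0) (hu 1)
    (@Functor.PreservesMonomorphisms.preserves _ _ _ _ G hGm _ _ _ h5) ?_
  rw [← Functor.map_comp, kernel.condition, Functor.map_zero]

lemma IsNakayama.gi (h : IsNakayama adj) {X : ModuleCat.{u} A} (hX : IsGorensteinInjective A X) :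
    IsGorensteinProjective A (G.obj X) ∧ IsIso (adj.counit.app X) := by
  obtain ⟨I, hI, hin, ht, ⟨e⟩⟩ := hX
  obtain ⟨h1, h2, h3⟩ := h.mapG hI hin ht
  have hFe : F.PreservesEpimorphisms := Functor.preservesEpimorphisms_of_adjunction adj
  have hGl : PreservesLimitsOfSize.{0, 0} G := adj.rightAdjoint_preservesLimits
  let eK := PreservesKernel.iso G (I.d 0 1)
  refine ⟨⟨mapC G I, h1, h2, h3, ⟨G.mapIso e ≪≫ eK⟩⟩, ?_⟩
  obtain ⟨h1', -, -⟩ := h.mapF h1 h2 h3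
  obtain ⟨h4, h5⟩ := ker_cmp (F := F) hFe h1 h1'
  refine isIso_app_of_iso adj.counit e ?_
  have hu := fun n => h.counit _ (hin n)
  obtain ⟨p, hp, -, -⟩ := exists_p hI
  refine gen_counit adj.counit (i := kernel.ι (I.d 0 1)) hp (hu _) (hu _) ?_
  exact gen_mono (F := F) eK (kernelComparison_comp_ι (I.d 0 1) G).symm h5

theorem main_of_nakayama (h : IsNakayama adj)
    (hgen : ∀ S : Set (DGI A), IsLocalizingSubcategory A S →
      (∀ M : ModuleCat.{u} A, IsGorensteinInjective A M → singleDGI A M ∈ S) →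
      S = Set.univ)
    (X : Cplx A) (hb : BoundedBelow A X) (hacyc : GPAcyclic A X)
    (hterms : ∀ n : ℤ, IsGorensteinProjective A (X.X n)) :
    Contractible A X := by
  have hu := fun n => (h.gp (hterms n)).2
  obtain ⟨H⟩ := core_contractible hgen (mapC F X)
    (by obtain ⟨a, ha⟩ := hb; exact ⟨a, fun n hn => F.map_isZero (ha n hn)⟩)
    (fun n => (h.gp (hterms n)).1)
    (fun J hJ => by
      have := (h.gi hJ).2
      exact tr3 adj (hacyc _ (h.gi hJ).1))
  let H2 := G.mapHomotopy H
  let φ : X ⟶ mapC G (mapC F X) :=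
    { f := fun n => adj.unit.app (X.X n)
      comm' := fun i j _ => (adj.unit.naturality (X.d i j)).symm }
  have : ∀ n, IsIso (φ.f n) := hu
  have : IsIso φ := HomologicalComplex.Hom.isIso_of_components φ
  refine ⟨(Homotopy.ofEq ?_).trans (((H2.compLeft φ).compRight (inv φ)).trans (Homotopy.ofEq ?_))⟩
  · simp
  · simp

end P3

section P4

variable {k : Type u} [CommRing k]

lemma exists_pseudo {I : Type u} [AddCommGroup I] [Module k I] (B D : Submodule k I)
    (h : Disjoint B D) :
    ∃ C, B ≤ C ∧ Disjoint C D ∧ ∀ C', C ≤ C' → Disjoint C' D → C' = C := by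
  obtain ⟨C, hBC, hC⟩ := zorn_le_nonempty₀ {C : Submodule k I | Disjoint C D} (by
    intro c hc hch y hy
    refine ⟨sSup c, ?_, fun z hz => le_sSup hz⟩
    change Disjoint (sSup c) D
    rw [hch.directedOn.disjoint_sSup_left]
    exact fun b hb => hc hb) B h
  exact ⟨C, hBC, hC.1, fun C' h1 h2 => le_antisymm (hC.2 h2 h1) h1⟩

lemma exists_ess {I : Type u} [AddCommGroup I] [Module k I] (hI : Module.Injective k I)
    (S : Submodule k I) : ∃ E : Submodule k I, S ≤ E ∧ Module.Injective k E ∧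
      ∀ x ∈ E, x ≠ 0 → ∃ r : k, r • x ∈ S ∧ r • x ≠ 0 := by
  obtain ⟨C, -, hCS, hC⟩ := exists_pseudo (⊥ : Submodule k I) S disjoint_bot_left
  obtain ⟨E, hSE, hEC, hE⟩ := exists_pseudo S C hCS.symm
  have hj : Function.Injective (E.mkQ ∘ₗ C.subtype) := by
    rw [← LinearMap.ker_eq_bot, eq_bot_iff]
    rintro ⟨x, hx⟩ hx'
    simp only [LinearMap.mem_ker, LinearMap.comp_apply, Submodule.mkQ_apply,
      Submodule.Quotient.mk_eq_zero, Submodule.subtype_apply] at hx'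
    simpa using Submodule.disjoint_def.1 hEC x hx' hx
  obtain ⟨g, hg⟩ := hI.out _ hj C.subtype
  let ψ : I →ₗ[k] I := g ∘ₗ E.mkQ
  have h1 : ∀ x ∈ C, ψ x = x := fun x hx => hg ⟨x, hx⟩
  have h2 : ∀ x ∈ E, ψ x = 0 := fun x hx => by
    simp [ψ, (Submodule.Quotient.mk_eq_zero E).2 hx]
  have h3 : ∀ x, ψ x ∈ S → ψ x = 0 := by
    have : S.comap ψ = E := by
      apply hE
      · intro x hx
        simp [h2 x hx]
      · rw [Submodule.disjoint_def]
        intro x hx hxC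
        simp only [Submodule.mem_comap, h1 x hxC] at hx
        exact Submodule.disjoint_def.1 hCS x hxC hx
    intro x hx
    exact h2 x (this ▸ (show x ∈ S.comap ψ from hx))
  have h4 : LinearMap.range ψ = C := by
    apply hC
    · intro x hx; exact ⟨x, h1 x hx⟩
    · rw [Submodule.disjoint_def]
      rintro _ ⟨x, rfl⟩ hx
      exact h3 x hx
  have h5 : LinearMap.ker ψ = E := by
    apply hE
    · exact fun x hx => h2 x hx
    · rw [Submodule.disjoint_def]
      intro x hx hxC
      rw [← h1 x hxC]; exact hx
  have h6 : ∀ x, ((LinearMap.id : I →ₗ[k] I) - ψ) x ∈ E := by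
    intro x
    rw [← h5]
    have : ψ x ∈ C := h4 ▸ ⟨x, rfl⟩
    simp [h1 _ this]
  refine ⟨E, hSE, ⟨fun X Y _ _ _ _ f hf g => ?_⟩, fun x hx hx0 => ?_⟩
  · obtain ⟨h, hh⟩ := hI.out f hf (E.subtype ∘ₗ g)
    refine ⟨(LinearMap.codRestrict E _ h6) ∘ₗ h, fun x => ?_⟩
    ext
    simp [hh, h2 _ (g x).2]
  · by_contra! hcon
    have hd : Disjoint (C ⊔ Submodule.span k {x}) S := by
      rw [Submodule.disjoint_def]
      intro y hy hyS
      obtain ⟨c, hc, n, hn, rfl⟩ := Submodule.mem_sup.1 hy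
      obtain ⟨r, rfl⟩ := Submodule.mem_span_singleton.1 hn
      have hcE : c ∈ E := by
        have := E.sub_mem (hSE hyS) (E.smul_mem r hx)
        simpa using this
      have hc0 := Submodule.disjoint_def.1 hEC c hcE hc
      subst hc0
      simp only [zero_add] at hyS ⊢
      exact hcon r hyS
    have := hC _ le_sup_left hd
    have hxC : x ∈ C := by
      rw [← this]
      exact Submodule.mem_sup_right (Submodule.mem_span_singleton_self x)
    exact hx0 (Submodule.disjoint_def.1 hEC x hx hxC)

lemma exists_emb (S : Type u) [AddCommGroup S] [Module k S] :
    ∃ (I : Type u) (_ : AddCommGroup I) (_ : Module k I) (i : S →ₗ[k] I),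
      Module.Injective k I ∧ Function.Injective i :=
  ⟨(Injective.under (ModuleCat.of k S) : ModuleCat.{u} k), inferInstance, inferInstance,
    (Injective.ι (ModuleCat.of k S)).hom,
    (Module.injective_iff_injective_object k _).2 (Injective.injective_under (ModuleCat.of k S)),
    (ModuleCat.mono_iff_injective _).1 inferInstance⟩

variable (k) in
lemma exists_matlis : ∃ (E : Type u) (_ : AddCommGroup E) (_ : Module k E),
    Module.Injective k E ∧ ∀ m : Ideal k, m.IsMaximal →
      ∃ e : E, e ≠ 0 ∧ (∀ a ∈ m, a • e = 0) ∧
        ∀ y : E, (∀ a ∈ m, a • y = 0) → y ∈ Submodule.span k {e} := by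
  classical
  obtain ⟨I, _, _, i, hI, hi⟩ := exists_emb (k := k) (∀ m : MaximalSpectrum k, k ⧸ m.asIdeal)
  obtain ⟨E, hSE, hE, hess⟩ := exists_ess hI (LinearMap.range i)
  refine ⟨E, inferInstance, inferInstance, hE, fun m hm => ?_⟩
  obtain ⟨δ, δ1, δ0⟩ : ∃ δ : (∀ m : MaximalSpectrum k, k ⧸ m.asIdeal), δ ⟨m, hm⟩ = 1 ∧
      ∀ m', m' ≠ ⟨m, hm⟩ → δ m' = 0 :=
    ⟨Pi.single ⟨m, hm⟩ 1, Pi.single_eq_same _ _, fun m' h => Pi.single_eq_of_ne h _⟩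
  have hq : ∀ (m' : MaximalSpectrum k) (b : k), b ∈ m'.asIdeal → ∀ x : k ⧸ m'.asIdeal,
      b • x = 0 := by
    intro m' b hb x
    rw [Algebra.smul_def]
    have : algebraMap k (k ⧸ m'.asIdeal) b = 0 := Ideal.Quotient.eq_zero_iff_mem.2 hb
    rw [this, zero_mul]
  refine ⟨⟨i δ, hSE ⟨δ, rfl⟩⟩, ?_, ?_, ?_⟩
  · intro h
    have h1 : i δ = i 0 := by rw [map_zero]; exact congrArg Subtype.val h
    have h2 := congrFun (hi h1) ⟨m, hm⟩
    rw [δ1] at h2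
    have : Nontrivial (k ⧸ m) := Ideal.Quotient.nontrivial_iff.2 hm.ne_top
    exact one_ne_zero h2
  · intro a ha
    apply Subtype.ext
    change a • i δ = 0
    rw [← map_smul, show a • δ = 0 from ?_, map_zero]
    funext m'
    change a • δ m' = 0
    by_cases hmm : m' = ⟨m, hm⟩
    · subst hmm
      exact hq _ _ ha _
    · rw [δ0 _ hmm, smul_zero]
  · rintro ⟨y, hyE⟩ hy
    have hy' : ∀ a ∈ m, a • y = 0 := fun a ha => congrArg Subtype.val (hy a ha)
    by_cases hy0 : y = 0
    · subst hy0; exact (Submodule.span k _).zero_mem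
    obtain ⟨r, hrS, hr0⟩ := hess y hyE hy0
    have hrm : r ∉ m := fun h => hr0 (hy' r h)
    obtain ⟨b, a, ha, hab⟩ := hm.exists_inv hrm
    have hyr : y = b • (r • y) := by
      have := hy' a ha
      rw [← mul_smul, show b * r = 1 - a by rw [← hab]; ring, sub_smul, this, one_smul, sub_zero]
    have hyS : y ∈ LinearMap.range i := by
      rw [hyr]; exact Submodule.smul_mem _ _ hrS
    obtain ⟨s, rfl⟩ := hyS
    have hs : ∀ a ∈ m, a • s = 0 := fun a ha => hi (by rw [map_smul, hy' a ha, map_zero])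
    obtain ⟨c, hc⟩ := Ideal.Quotient.mk_surjective (s ⟨m, hm⟩)
    refine Submodule.mem_span_singleton.2 ⟨c, ?_⟩
    apply Subtype.ext
    change c • i δ = i s
    rw [← map_smul]
    congr 1
    funext m'
    change c • δ m' = s m'
    by_cases hmm : m' = ⟨m, hm⟩
    · subst hmm
      rw [δ1, Algebra.smul_def, mul_one]
      exact hc
    · rw [δ0 _ hmm, smul_zero]
      have hne : m ≠ m'.asIdeal := fun h => hmm (MaximalSpectrum.ext h.symm)
      have hsup := hm.coprime_of_ne m'.isMaximal hne
      obtain ⟨a, ha, b, hb, hab⟩ := Submodule.mem_sup.1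
        (show (1 : k) ∈ m ⊔ m'.asIdeal by rw [hsup]; trivial)
      have e1 : a • s m' = 0 := congrFun (hs a ha) m'
      rw [← one_smul k (s m'), ← hab, add_smul, e1, hq _ _ hb, add_zero]

end P4

section P5

variable {k : Type u} [CommRing k] {E : Type u} [AddCommGroup E] [Module k E]

variable (k E) in
/-- The properties of a minimal injective cogenerator which are used. -/
structure IsMatlis : Prop where
  inj : Module.Injective k E
  soc : ∀ m : Ideal k, m.IsMaximal →
      ∃ e : E, e ≠ 0 ∧ (∀ a ∈ m, a • e = 0) ∧
        ∀ y : E, (∀ a ∈ m, a • y = 0) → y ∈ Submodule.span k {e}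

lemma IsMatlis.sep (h : IsMatlis k E) {M : Type u} [AddCommGroup M] [Module k M] {x : M}
    (hx : x ≠ 0) : ∃ g : M →ₗ[k] E, g x ≠ 0 := by
  let I : Ideal k := LinearMap.ker (LinearMap.toSpanSingleton k M x)
  have hI : I ≠ ⊤ := by
    rw [Ideal.ne_top_iff_one]
    intro h1
    simp only [I, LinearMap.mem_ker, LinearMap.toSpanSingleton_apply, one_smul] at h1
    exact hx h1
  obtain ⟨m, hm, hIm⟩ := Ideal.exists_le_maximal I hI
  obtain ⟨e, he0, hem, -⟩ := h.soc m hm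
  let a : (k ⧸ I) →ₗ[k] M := I.liftQ (LinearMap.toSpanSingleton k M x) le_rfl
  have ha : Function.Injective a := by
    rw [← LinearMap.ker_eq_bot]
    exact Submodule.ker_liftQ_eq_bot _ _ _ le_rfl
  let b : (k ⧸ I) →ₗ[k] E := I.liftQ (LinearMap.toSpanSingleton k E e) (fun t ht => by
    simpa using hem t (hIm ht))
  obtain ⟨g, hg⟩ := h.inj.out a ha b
  refine ⟨g, ?_⟩
  have h1 := hg (Submodule.Quotient.mk 1)
  have h2 : a (Submodule.Quotient.mk 1) = x := by
    change LinearMap.toSpanSingleton k M x 1 = x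
    simp
  have h3 : b (Submodule.Quotient.mk 1) = e := by
    change LinearMap.toSpanSingleton k E e 1 = e
    simp
  rw [h2, h3] at h1
  rwa [h1]

lemma IsMatlis.length_simple (h : IsMatlis k E) {M : Type u} [AddCommGroup M] [Module k M]
    [IsSimpleModule k M] : Module.length k (M →ₗ[k] E) ≤ 1 := by
  have hnt := IsSimpleModule.nontrivial k M
  obtain ⟨x, hx⟩ := exists_ne (0 : M)
  have hs := IsSimpleModule.toSpanSingleton_surjective k hx
  let m : Ideal k := LinearMap.ker (LinearMap.toSpanSingleton k M x)
  have hm : m.IsMaximal := IsSimpleModule.ker_toSpanSingleton_isMaximal k hx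
  obtain ⟨e, he0, hem, hsp⟩ := h.soc m hm
  let b : (k ⧸ m) →ₗ[k] E := m.liftQ (LinearMap.toSpanSingleton k E e) (fun t ht => by
    simpa using hem t ht)
  have hsimp : IsSimpleModule k (k ⧸ m) := isSimpleModule_iff_isCoatom.2 hm.out
  have h1 : Module.length k (LinearMap.range b) ≤ 1 := by
    rw [← Module.length_eq_one k (k ⧸ m)]
    exact Module.length_le_of_surjective b.rangeRestrict b.surjective_rangeRestrict
  refine le_trans ?_ h1
  refine Module.length_le_of_injective
    (LinearMap.codRestrict (LinearMap.range b) (LinearMap.applyₗ x) ?_) ?_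
  · intro f
    have : f x ∈ Submodule.span k {e} := hsp _ (fun a ha => by
      have ha' : a • x = 0 := ha
      rw [← map_smul, ha', map_zero])
    obtain ⟨c, hc⟩ := Submodule.mem_span_singleton.1 this
    exact ⟨Submodule.Quotient.mk c, hc⟩
  · intro f g hfg
    have hfg' : f x = g x := congrArg Subtype.val hfg
    ext y
    obtain ⟨c, rfl⟩ := hs y
    simp [hfg']

lemma IsMatlis.length_le (h : IsMatlis k E) {M : Type u} [AddCommGroup M] [Module k M]
    (hM : IsFiniteLength k M) : Module.length k (M →ₗ[k] E) ≤ Module.length k M := by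
  induction hM with
  | of_subsingleton => simp
  | @of_simple_quotient M _ _ N _ _ ih =>
    rw [Module.length_eq_add_of_exact N.subtype N.mkQ N.injective_subtype N.mkQ_surjective
      (LinearMap.exact_subtype_mkQ N)]
    have hex : Function.Exact (LinearMap.lcomp k E N.mkQ) (LinearMap.lcomp k E N.subtype) := by
      intro f
      constructor
      · intro hf
        refine ⟨N.liftQ f ?_, ?_⟩
        · intro x hx
          exact LinearMap.congr_fun hf ⟨x, hx⟩
        · ext x; rfl
      · rintro ⟨g, rfl⟩
        ext x
        change g (Submodule.Quotient.mk x.1) = 0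
        rw [(Submodule.Quotient.mk_eq_zero N).2 x.2, map_zero]
    rw [Module.length_eq_add_of_exact (LinearMap.lcomp k E N.mkQ) (LinearMap.lcomp k E N.subtype)
      ?_ ?_ hex, add_comm]
    · refine add_le_add ih ?_
      rw [Module.length_eq_one k (M ⧸ N)]
      exact h.length_simple
    · intro f g hfg
      ext x
      exact LinearMap.congr_fun hfg x
    · intro g
      obtain ⟨f, hf⟩ := h.inj.out N.subtype N.injective_subtype g
      exact ⟨f, LinearMap.ext hf⟩

lemma IsMatlis.finiteLength (h : IsMatlis k E) {M : Type u} [AddCommGroup M] [Module k M]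
    (hM : IsFiniteLength k M) : IsFiniteLength k (M →ₗ[k] E) := by
  rw [← Module.length_ne_top_iff] at hM ⊢
  exact ne_top_of_le_ne_top hM (h.length_le (Module.length_ne_top_iff.1 hM))

lemma IsMatlis.bidual (h : IsMatlis k E) {M : Type u} [AddCommGroup M] [Module k M]
    (hM : IsFiniteLength k M) (φ : (M →ₗ[k] E) →ₗ[k] E) : ∃ x : M, ∀ f, φ f = f x := by
  let ev : M →ₗ[k] ((M →ₗ[k] E) →ₗ[k] E) := LinearMap.applyₗ
  have hinj : Function.Injective ev := by
    rw [injective_iff_map_eq_zero]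
    intro x hx
    by_contra hx0
    obtain ⟨g, hg⟩ := h.sep hx0
    exact hg (LinearMap.congr_fun hx g)
  have hD := h.finiteLength hM
  have hDD := h.finiteLength hD
  obtain ⟨_, _⟩ := isFiniteLength_iff_isNoetherian_isArtinian.1 hDD
  have hs : LinearMap.range ev = ⊤ := by
    by_contra hne
    have h1 := Submodule.length_lt hne
    have h2 : Module.length k M ≤ Module.length k (LinearMap.range ev) :=
      Module.length_le_of_injective ev.rangeRestrict
        (fun a b hab => hinj (congrArg Subtype.val hab))
    exact absurd (h2.trans_lt h1) (not_lt.2 ((h.length_le hD).trans (h.length_le hM)))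
  obtain ⟨x, hx⟩ := LinearMap.range_eq_top.1 hs φ
  exact ⟨x, fun f => by rw [← hx]; rfl⟩

end P5

section P6

variable {k : Type u} [CommRing k] {E : Type u} [AddCommGroup E] [Module k E]
  {B : Type u} [Ring B] [Algebra k B]

variable (k E B) in
/-- The dual of the regular module. -/
def NakT : Type u := B →ₗ[k] E

noncomputable instance : AddCommGroup (NakT k E B) := inferInstanceAs (AddCommGroup (B →ₗ[k] E))
noncomputable instance : Module k (NakT k E B) := inferInstanceAs (Module k (B →ₗ[k] E))

/-- The underlying linear map. -/
def NakT.f (t : NakT k E B) : B →ₗ[k] E := t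

lemma NakT.ext {s t : NakT k E B} (h : ∀ x, s.f x = t.f x) : s = t := LinearMap.ext h
lemma NakT.add_f (s t : NakT k E B) (x : B) : (s + t).f x = s.f x + t.f x := rfl
lemma NakT.zero_f (x : B) : (0 : NakT k E B).f x = 0 := rfl
lemma NakT.ksmul_f (c : k) (t : NakT k E B) (x : B) : (c • t).f x = c • t.f x := rfl

noncomputable instance : SMul B (NakT k E B) :=
  ⟨fun a t => show B →ₗ[k] E from t.f ∘ₗ LinearMap.mulRight k a⟩

lemma NakT.smul_f (a : B) (t : NakT k E B) (x : B) : (a • t).f x = t.f (x * a) := rfl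

noncomputable instance : Module B (NakT k E B) where
  one_smul t := NakT.ext fun x => by rw [NakT.smul_f, mul_one]
  mul_smul a b t := NakT.ext fun x => by simp only [NakT.smul_f, mul_assoc]
  smul_zero a := NakT.ext fun x => rfl
  smul_add a s t := NakT.ext fun x => rfl
  add_smul a b t := NakT.ext fun x => by
    simp only [NakT.add_f, NakT.smul_f, mul_add, map_add]
  zero_smul t := NakT.ext fun x => by
    simp only [NakT.smul_f, mul_zero, map_zero, NakT.zero_f]

instance : IsScalarTower k B (NakT k E B) where
  smul_assoc c a t := NakT.ext fun x => by
    simp only [NakT.ksmul_f, NakT.smul_f, mul_smul_comm, map_smul]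

/-- The adjoint map. -/
def NakT.lift {M : Type*} [AddCommGroup M] [Module B M] [Module k M] [IsScalarTower k B M]
    (g : M →ₗ[k] E) : M →ₗ[B] NakT k E B where
  toFun m := show B →ₗ[k] E from
    { toFun := fun a => g (a • m)
      map_add' := fun a b => by rw [add_smul, map_add]
      map_smul' := fun c a => by rw [smul_assoc, map_smul]; rfl }
  map_add' m n := NakT.ext fun x => show g (x • (m + n)) = g (x • m) + g (x • n) by
    rw [smul_add, map_add]
  map_smul' a m := NakT.ext fun x => show g (x • a • m) = g ((x * a) • m) by rw [mul_smul]

lemma NakT.lift_f {M : Type*} [AddCommGroup M] [Module B M] [Module k M] [IsScalarTower k B M]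
    (g : M →ₗ[k] E) (m : M) (x : B) : (NakT.lift (B := B) g m).f x = g (x • m) := rfl

/-- The right action. -/
noncomputable def NakT.R (a : B) : NakT k E B →ₗ[B] NakT k E B where
  toFun t := show B →ₗ[k] E from t.f ∘ₗ LinearMap.mulLeft k a
  map_add' m n := rfl
  map_smul' b m := NakT.ext fun x => show m.f (a * x * b) = m.f (a * (x * b)) by rw [mul_assoc]

lemma NakT.R_f (a : B) (t : NakT k E B) (x : B) : (NakT.R a t).f x = t.f (a * x) := rfl

lemma NakT.injective (h : IsMatlis k E) : Module.Injective B (NakT k E B) := by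
  apply Module.Baer.injective
  intro I g
  let g1 : I →ₗ[k] E :=
    { toFun := fun i => (g i).f 1
      map_add' := fun a b => by rw [map_add]; rfl
      map_smul' := fun c a => by
        have : g (c • a) = c • g a := by
          rw [← one_smul B a, ← smul_assoc, map_smul, smul_assoc, one_smul]
          simp
        rw [this]; rfl }
  obtain ⟨h1, hh⟩ := h.inj.out (I.subtype.restrictScalars k) I.injective_subtype g1
  refine ⟨NakT.lift h1, fun x hx => NakT.ext fun a => ?_⟩
  rw [NakT.lift_f]
  have e1 := hh (a • ⟨x, hx⟩)
  have e2 : g1 (a • ⟨x, hx⟩) = (g ⟨x, hx⟩).f a := by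
    change (g (a • ⟨x, hx⟩)).f 1 = _
    rw [map_smul, NakT.smul_f, one_mul]
  rw [← e2, ← e1]
  rfl

lemma NakT.sep (h : IsMatlis k E) {M : Type u} [AddCommGroup M] [Module B M] {x : M}
    (hx : x ≠ 0) : ∃ g : M →ₗ[B] NakT k E B, g x ≠ 0 := by
  letI : Module k M := Module.compHom M (algebraMap k B)
  haveI : IsScalarTower k B M := ⟨fun c a m => by
    change _ = algebraMap k B c • a • m
    rw [Algebra.smul_def, mul_smul]⟩
  obtain ⟨g, hg⟩ := h.sep hx
  refine ⟨NakT.lift g, fun h0 => hg ?_⟩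
  have := NakT.lift_f (B := B) g x 1
  rw [h0, one_smul] at this
  rw [← this]; rfl

/-- The ring map. -/
noncomputable def NakT.ρ : B →+* (End (ModuleCat.of B (NakT k E B)))ᵐᵒᵖ where
  toFun a := MulOpposite.op (ModuleCat.ofHom (NakT.R a))
  map_one' := by
    congr 1
    refine ModuleCat.hom_ext (LinearMap.ext fun t => NakT.ext fun x => ?_)
    change t.f (1 * x) = t.f x
    rw [one_mul]
  map_mul' a b := by
    rw [← MulOpposite.op_mul]
    congr 1
    refine ModuleCat.hom_ext (LinearMap.ext fun t => NakT.ext fun x => ?_)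
    change t.f (a * b * x) = t.f (a * (b * x))
    rw [mul_assoc]
  map_zero' := by
    congr 1
    refine ModuleCat.hom_ext (LinearMap.ext fun t => NakT.ext fun x => ?_)
    change t.f (0 * x) = 0
    rw [zero_mul, map_zero]
  map_add' a b := by
    rw [← MulOpposite.op_add]
    congr 1
    refine ModuleCat.hom_ext (LinearMap.ext fun t => NakT.ext fun x => ?_)
    change t.f ((a + b) * x) = t.f (a * x) + t.f (b * x)
    rw [add_mul, map_add]

lemma NakT.ρ_bij (h : IsMatlis k E) (hA : IsFiniteLength k B) :
    Function.Bijective (NakT.ρ (k := k) (E := E) (B := B)) := by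
  constructor
  · rw [injective_iff_map_eq_zero]
    intro a ha
    by_contra h0
    obtain ⟨g, hg⟩ := h.sep h0
    apply hg
    have h1 : NakT.R a (show NakT k E B from g) = 0 :=
      congrArg (fun t => (MulOpposite.unop t).hom (show NakT k E B from g)) ha
    have h2 := NakT.R_f a (show NakT k E B from g) 1
    rw [h1, mul_one] at h2
    exact h2.symm
  · intro φ
    let ψ : NakT k E B →ₗ[B] NakT k E B := φ.unop.hom
    obtain ⟨a, ha⟩ := h.bidual hA
      { toFun := fun f => (ψ (show NakT k E B from f)).f 1
        map_add' := fun f g => by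
          change (ψ ((show NakT k E B from f) + (show NakT k E B from g))).f 1 = _
          rw [map_add]; rfl
        map_smul' := fun c f => by
          change (ψ (c • (show NakT k E B from f))).f 1 = _
          rw [← one_smul B (show NakT k E B from f), ← smul_assoc, map_smul, smul_assoc, one_smul,
            one_smul]
          rfl }
    refine ⟨a, MulOpposite.unop_injective ?_⟩
    refine ModuleCat.hom_ext (LinearMap.ext fun t => NakT.ext fun x => ?_)
    change t.f (a * x) = (ψ t).f x
    have h1 : (ψ (x • t)).f 1 = (x • t).f a := ha (x • t).f
    rw [map_smul, NakT.smul_f, one_mul, NakT.smul_f] at h1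
    exact h1.symm

lemma NakT.finite (h : IsMatlis k E) (hA : IsFiniteLength k B) :
    Module.Finite B (NakT k E B) := by
  have h1 := h.finiteLength hA
  obtain ⟨h2, -⟩ := isFiniteLength_iff_isNoetherian_isArtinian.1 h1
  have h3 : Module.Finite k (NakT k E B) :=
    inferInstanceAs (Module.Finite k (B →ₗ[k] E))
  exact Module.Finite.of_restrictScalars_finite k B (NakT k E B)

variable (k B) in
lemma exists_nakT [IsArtinianRing k] [Module.Finite k B] :
    ∃ T : ModuleCat.{u} B, Module.Finite B T ∧ Module.Injective B T ∧
      (∀ (M : Type u) [AddCommGroup M] [Module B M] (x : M), x ≠ 0 →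
        ∃ g : M →ₗ[B] T, g x ≠ 0) ∧ Nonempty (B ≃+* (End T)ᵐᵒᵖ) ∧
      IsNoetherianRing B ∧ IsArtinianRing B := by
  obtain ⟨E, _, _, h1, h2⟩ := exists_matlis k
  have h : IsMatlis k E := ⟨h1, h2⟩
  have hA : IsFiniteLength k B :=
    isFiniteLength_iff_isNoetherian_isArtinian.2 ⟨inferInstance, inferInstance⟩
  exact ⟨ModuleCat.of B (NakT k E B), NakT.finite h hA, NakT.injective h,
    fun M _ _ x hx => NakT.sep h hx, ⟨RingEquiv.ofBijective _ (NakT.ρ_bij h hA)⟩,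
    isNoetherian_of_tower k inferInstance, isArtinian_of_tower k inferInstance⟩

end P6

section P7

variable {B : Type u} [Ring B] {T : Type u} [AddCommGroup T] [Module B T]

lemma fin_supp {M : Type u} [AddCommGroup M] [Module B M] [hM : Module.Finite B M] {ι : Type u}
    (φ : M →ₗ[B] (ι →₀ T)) : ∃ s : Finset ι, ∀ m, ∀ i ∉ s, φ m i = 0 := by
  classical
  obtain ⟨S, hS⟩ := hM.fg_top
  refine ⟨S.biUnion fun m => (φ m).support, fun m i hi => ?_⟩
  have hm : m ∈ Submodule.span B (S : Set M) := by rw [hS]; trivial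
  induction hm using Submodule.span_induction with
  | mem x hx =>
    by_contra h
    exact hi (Finset.mem_biUnion.2 ⟨x, hx, Finsupp.mem_support_iff.2 h⟩)
  | zero => simp
  | add x y _ _ hx hy => simp [hx, hy]
  | smul a x _ hx => simp [hx]

lemma finsupp_inj [IsNoetherianRing B] (hT : Module.Injective B T) (ι : Type u) :
    Module.Injective B (ι →₀ T) := by
  apply Module.Baer.injective
  intro I g
  obtain ⟨s, hs⟩ := fin_supp g
  choose h hh using fun i => hT.out I.subtype I.injective_subtype (Finsupp.lapply i ∘ₗ g)
  refine ⟨∑ i ∈ s, Finsupp.lsingle i ∘ₗ h i, fun x hx => ?_⟩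
  have h1 : ∀ i, h i x = g ⟨x, hx⟩ i := fun i => hh i ⟨x, hx⟩
  ext i
  simp only [LinearMap.sum_apply, LinearMap.comp_apply, h1, Finsupp.lsingle_apply,
    Finsupp.finsetSum_apply]
  classical
  by_cases hi : i ∈ s
  · rw [Finset.sum_eq_single_of_mem i hi]
    · simp
    · intro b _ hb
      simp [hb]
  · rw [hs _ i hi]
    refine Finset.sum_eq_zero fun b hb => ?_
    rw [Finsupp.single_apply, if_neg]
    rintro rfl
    exact hi hb

lemma exists_simple_le [IsArtinianRing B] {M : Type u} [AddCommGroup M] [Module B M] {x : M}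
    (hx : x ≠ 0) : ∃ N : Submodule B M, IsSimpleModule B N ∧ N ≤ Submodule.span B {x} := by
  have hne : Submodule.span B {x} ≠ ⊥ := by simpa using hx
  have : IsArtinian B (Submodule.span B {x}) := inferInstance
  obtain ⟨N, hN, -⟩ := (IsAtomic.eq_bot_or_exists_atom_le
    (⊤ : Submodule B (Submodule.span B {x}))).resolve_left (by
      intro h
      apply hne
      have := congrArg (Submodule.map (Submodule.span B {x}).subtype) h
      simpa using this)
  have hs : IsSimpleModule B N := isSimpleModule_iff_isAtom.2 hN
  refine ⟨N.map (Submodule.span B {x}).subtype, ?_, Submodule.map_subtype_le _ _⟩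
  exact IsSimpleModule.congr
    (Submodule.equivMapOfInjective _ (Submodule.span B {x}).injective_subtype N).symm

lemma exists_emb_finsupp [IsNoetherianRing B] [IsArtinianRing B] (hT : Module.Injective B T)
    (hsep : ∀ (M : Type u) [AddCommGroup M] [Module B M] (x : M), x ≠ 0 →
        ∃ g : M →ₗ[B] T, g x ≠ 0) (M : Type u) [AddCommGroup M] [Module B M] :
    ∃ (ι : Type u) (j : M →ₗ[B] (ι →₀ T)), Function.Injective j := by
  classical
  let S : Submodule B M := sSup {m : Submodule B M | IsSimpleModule B m}
  have hS : IsSemisimpleModule B S := by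
    have : S = ⨆ m ∈ {m : Submodule B M | IsSimpleModule B m}, m := sSup_eq_iSup
    rw [this]
    exact isSemisimpleModule_biSup_of_isSemisimpleModule_submodule (p := fun m => m)
      (fun m hm => by
        have : IsSimpleModule B m := hm
        infer_instance)
  obtain ⟨s, e, -, hs⟩ := IsSemisimpleModule.exists_linearEquiv_dfinsupp B S
  have hinj : ∀ m : s, ∃ g : m.1 →ₗ[B] T, Function.Injective g := by
    intro m
    have := hs m
    have hnt := IsSimpleModule.nontrivial B m.1
    obtain ⟨x, hx⟩ := exists_ne (0 : m.1)
    obtain ⟨g, hg⟩ := hsep m.1 x hx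
    refine ⟨g, (LinearMap.injective_or_eq_zero g).resolve_right ?_⟩
    rintro rfl
    exact hg rfl
  choose g hg using hinj
  let j0 : S →ₗ[B] (s →₀ T) := (finsuppLequivDFinsupp B).symm.toLinearMap ∘ₗ
    DFinsupp.mapRange.linearMap g ∘ₗ e.toLinearMap
  have hj0 : Function.Injective j0 := by
    have hm : Function.Injective (DFinsupp.mapRange.linearMap g) :=
      (DFinsupp.mapRange_injective _ fun _ => map_zero _).2 hg
    intro a b hab
    exact e.injective (hm ((finsuppLequivDFinsupp B).symm.injective hab))
  obtain ⟨j, hj⟩ := (finsupp_inj hT s).out S.subtype S.injective_subtype j0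
  refine ⟨s, j, ?_⟩
  rw [injective_iff_map_eq_zero]
  intro x hx
  by_contra hx0
  obtain ⟨N, hN, hNx⟩ := exists_simple_le (B := B) hx0
  have hnt := IsSimpleModule.nontrivial B N
  obtain ⟨y, hy⟩ := exists_ne (0 : N)
  obtain ⟨a, ha⟩ := Submodule.mem_span_singleton.1 (hNx y.2)
  have hyS : y.1 ∈ S := (le_sSup (show N ∈ {m : Submodule B M | IsSimpleModule B m} from hN)) y.2
  have h1 := hj ⟨y.1, hyS⟩
  have h2 : j y.1 = 0 := by rw [← ha, map_smul, hx, smul_zero]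
  rw [Submodule.subtype_apply, h2] at h1
  have h3 : (⟨y.1, hyS⟩ : S) = 0 := hj0 (by rw [← h1, map_zero])
  have h4 : y.1 = 0 := congrArg Subtype.val h3
  exact hy (Subtype.ext h4)

end P7

section P8

variable {A} {T : ModuleCat.{u} A}

/-- The functor `Hom(T, -)`. -/
noncomputable def nakG (ρ : A ≃+* (End T)ᵐᵒᵖ) : ModuleCat.{u} A ⥤ ModuleCat.{u} A :=
  preadditiveCoyonedaObj T ⋙ ModuleCat.restrictScalars ρ.toRingHom

instance (ρ : A ≃+* (End T)ᵐᵒᵖ) : (nakG ρ).Additive := by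
  unfold nakG; infer_instance

/-- The morphism attached to an element. -/
def nakEl (ρ : A ≃+* (End T)ᵐᵒᵖ) {M : ModuleCat.{u} A} (x : (nakG ρ).obj M) : T ⟶ M := x

/-- The element attached to a morphism. -/
def nakMk (ρ : A ≃+* (End T)ᵐᵒᵖ) {M : ModuleCat.{u} A} (x : T ⟶ M) : (nakG ρ).obj M := x

/-- The right action. -/
def nakR (ρ : A ≃+* (End T)ᵐᵒᵖ) (a : A) : T ⟶ T := (ρ a).unop

lemma nakR_zero (ρ : A ≃+* (End T)ᵐᵒᵖ) : nakR ρ 0 = 0 := by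
  unfold nakR; rw [map_zero]; rfl

lemma nakR_add (ρ : A ≃+* (End T)ᵐᵒᵖ) (a b : A) : nakR ρ (a + b) = nakR ρ a + nakR ρ b := by
  unfold nakR; rw [map_add]; rfl

lemma nakR_inj (ρ : A ≃+* (End T)ᵐᵒᵖ) {a : A} (h : nakR ρ a = 0) : a = 0 := by
  apply ρ.injective
  rw [map_zero]
  exact MulOpposite.unop_injective h

lemma nakR_surj (ρ : A ≃+* (End T)ᵐᵒᵖ) (f : T ⟶ T) : ∃ a, nakR ρ a = f := by
  refine ⟨ρ.symm (MulOpposite.op f), ?_⟩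
  unfold nakR; rw [RingEquiv.apply_symm_apply]; rfl

lemma nakEl_map (ρ : A ≃+* (End T)ᵐᵒᵖ) {M N : ModuleCat.{u} A} (h : M ⟶ N)
    (x : (nakG ρ).obj M) : nakEl ρ ((nakG ρ).map h x) = nakEl ρ x ≫ h := rfl

lemma nakEl_smul (ρ : A ≃+* (End T)ᵐᵒᵖ) {M : ModuleCat.{u} A} (a : A)
    (x : (nakG ρ).obj M) : nakEl ρ (a • x) = nakR ρ a ≫ nakEl ρ x := rfl

lemma nakEl_add (ρ : A ≃+* (End T)ᵐᵒᵖ) {M : ModuleCat.{u} A}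
    (x y : (nakG ρ).obj M) : nakEl ρ (x + y) = nakEl ρ x + nakEl ρ y := rfl

lemma exists_nakF (ρ : A ≃+* (End T)ᵐᵒᵖ) :
    ∃ F : ModuleCat.{u} A ⥤ ModuleCat.{u} A, Nonempty (F ⊣ nakG ρ) :=
  ⟨_, ⟨(ModuleCat.restrictScalarsEquivalenceOfRingEquiv ρ).symm.toAdjunction.comp
    (IsGrothendieckAbelian.tensorObjPreadditiveCoyonedaObjAdjunction T)⟩⟩

variable {ρ : A ≃+* (End T)ᵐᵒᵖ} {F : ModuleCat.{u} A ⥤ ModuleCat.{u} A}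

/-- The canonical maps. -/
noncomputable def nakX (adj : F ⊣ nakG ρ) (ι : Type u) (i : ι) :
    T ⟶ F.obj (ModuleCat.of A (ι →₀ A)) :=
  nakEl ρ (adj.unit.app (ModuleCat.of A (ι →₀ A)) (Finsupp.single i (1 : A)))

lemma nakX_desc (adj : F ⊣ nakG ρ) (ι : Type u) {M : ModuleCat.{u} A} (g : ι → (T ⟶ M)) :
    ∃ h : F.obj (ModuleCat.of A (ι →₀ A)) ⟶ M, ∀ i, nakX adj ι i ≫ h = g i := by
  let f : ModuleCat.of A (ι →₀ A) ⟶ (nakG ρ).obj M :=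
    ModuleCat.ofHom (Y := (nakG ρ).obj M) (Finsupp.linearCombination (M := (nakG ρ).obj M) A fun i => nakMk ρ (g i))
  refine ⟨(adj.homEquiv _ _).symm f, fun i => ?_⟩
  have h1 := (adj.homEquiv _ _).apply_symm_apply f
  rw [Adjunction.homEquiv_unit] at h1
  rw [nakX, ← nakEl_map]
  have h2 : (adj.unit.app _ ≫ (nakG ρ).map ((adj.homEquiv _ _).symm f))
    (Finsupp.single i (1 : A)) = f (Finsupp.single i (1 : A)) := by rw [h1]
  have h3 : f (Finsupp.single i (1 : A)) = nakMk ρ (g i) := by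
    change Finsupp.linearCombination (M := (nakG ρ).obj M) A (fun i => nakMk ρ (g i)) (Finsupp.single i (1 : A)) = _
    rw [Finsupp.linearCombination_single, one_smul]
  exact congrArg (nakEl ρ) (h2.trans h3)

lemma nakX_ext (adj : F ⊣ nakG ρ) (ι : Type u) {M : ModuleCat.{u} A}
    {h h' : F.obj (ModuleCat.of A (ι →₀ A)) ⟶ M}
    (hh : ∀ i, nakX adj ι i ≫ h = nakX adj ι i ≫ h') : h = h' := by
  apply (adj.homEquiv _ _).injective
  rw [Adjunction.homEquiv_unit, Adjunction.homEquiv_unit]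
  apply ModuleCat.hom_ext
  apply Finsupp.lhom_ext'
  intro i
  apply LinearMap.ext_ring
  exact hh i

/-- The free module goes to the direct sum. -/
lemma nak_iso (adj : F ⊣ nakG ρ) (ι : Type u) :
    ∃ θ : F.obj (ModuleCat.of A (ι →₀ A)) ≅ ModuleCat.of A (ι →₀ T),
      ∀ i, nakX adj ι i ≫ θ.hom = ModuleCat.ofHom (Finsupp.lsingle i) := by
  obtain ⟨h, hh⟩ := nakX_desc adj ι
    (fun i => (ModuleCat.ofHom (Finsupp.lsingle i) : T ⟶ ModuleCat.of A (ι →₀ T)))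
  let h' : ModuleCat.of A (ι →₀ T) ⟶ F.obj (ModuleCat.of A (ι →₀ A)) :=
    ModuleCat.ofHom (Finsupp.lsum ℕ fun i => (nakX adj ι i).hom)
  have hs : ∀ i, (ModuleCat.ofHom (Finsupp.lsingle i) : T ⟶ ModuleCat.of A (ι →₀ T)) ≫ h' =
      nakX adj ι i := by
    intro i
    ext t
    simp [h']
  refine ⟨⟨h, h', ?_, ?_⟩, hh⟩
  · apply nakX_ext adj
    intro i
    rw [← Category.assoc, hh, hs, Category.comp_id]
  · apply ModuleCat.hom_ext
    apply Finsupp.lhom_ext'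
    intro i
    have : (ModuleCat.ofHom (Finsupp.lsingle i) : T ⟶ ModuleCat.of A (ι →₀ T)) ≫ (h' ≫ h) =
      ModuleCat.ofHom (Finsupp.lsingle i) := by rw [← Category.assoc, hs, hh]
    exact congrArg ModuleCat.Hom.hom this

lemma nak_unit_free [hT : Module.Finite A T] (adj : F ⊣ nakG ρ) (ι : Type u) :
    IsIso (adj.unit.app (ModuleCat.of A (ι →₀ A))) := by
  classical
  obtain ⟨θ, hθ⟩ := nak_iso adj ι
  have key : ∀ (b : ι →₀ A) (t : T) (i : ι),
      θ.hom (nakEl ρ (adj.unit.app (ModuleCat.of A (ι →₀ A)) b) t) i = nakR ρ (b i) t := by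
    intro b t i
    let L : (ι →₀ A) →+ T :=
      { toFun := fun b => θ.hom (nakEl ρ (adj.unit.app (ModuleCat.of A (ι →₀ A)) b) t) i
        map_zero' := by
          rw [map_zero]
          change θ.hom ((0 : T ⟶ _) t) i = 0
          simp
        map_add' := fun b c => by
          rw [map_add, nakEl_add]
          simp }
    let R : (ι →₀ A) →+ T :=
      { toFun := fun b => nakR ρ (b i) t
        map_zero' := by
          rw [Finsupp.coe_zero, Pi.zero_apply, nakR_zero]
          rfl
        map_add' := fun b c => by
          rw [Finsupp.coe_add, Pi.add_apply, nakR_add]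
          rfl }
    have : L = R := by
      apply Finsupp.addHom_ext
      intro j a
      change θ.hom (nakEl ρ (adj.unit.app (ModuleCat.of A (ι →₀ A)) (Finsupp.single j a)) t) i =
        nakR ρ (Finsupp.single j a i) t
      have e1 : (Finsupp.single j a : ι →₀ A) = a • Finsupp.single j (1 : A) := by simp
      rw [e1, map_smul, nakEl_smul]
      have e2 : θ.hom (nakX adj ι j (nakR ρ a t)) = Finsupp.single j (nakR ρ a t) :=
        congrArg (fun q => q.hom (nakR ρ a t)) (hθ j)
      change θ.hom (nakX adj ι j (nakR ρ a t)) i = _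
      rw [e2, ← e1]
      by_cases hij : j = i
      · subst hij; simp
      · simp only [Finsupp.single_apply, if_neg hij, nakR_zero]
        rfl
    exact DFunLike.congr_fun this b
  rw [ConcreteCategory.isIso_iff_bijective]
  constructor
  · rw [injective_iff_map_eq_zero]
    intro b hb
    refine Finsupp.ext fun i => nakR_inj ρ ?_
    apply ModuleCat.hom_ext
    ext t
    have := key b t i
    rw [hb] at this
    refine this.symm.trans ?_
    change θ.hom ((0 : T ⟶ _) t) i = 0
    simp
  · intro φ
    obtain ⟨s, hs⟩ := fin_supp (nakEl ρ φ ≫ θ.hom).hom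
    choose c hc' using fun i => nakR_surj ρ
      (nakEl ρ φ ≫ θ.hom ≫ ModuleCat.ofHom (Finsupp.lapply i))
    have hc : ∀ i t, nakR ρ (c i) t = θ.hom (nakEl ρ φ t) i := by
      intro i t
      rw [hc']
      rfl
    have hc0 : ∀ i, i ∉ s → c i = 0 := by
      intro i hi
      apply nakR_inj ρ
      apply ModuleCat.hom_ext
      ext t
      exact (hc i t).trans (hs t i hi)
    refine ⟨Finsupp.onFinset s c (fun i hi => by by_contra h; exact hi (hc0 i h)), ?_⟩
    change nakEl ρ _ = nakEl ρ φ
    rw [← cancel_mono θ.hom]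
    apply ModuleCat.hom_ext
    ext t i
    exact (key _ t i).trans (hc i t)

lemma retract_iso {C D : Type*} [Category C] [Category D] {H K : C ⥤ D} (τ : H ⟶ K) {X Y : C}
    (i : X ⟶ Y) (r : Y ⟶ X) (w : i ≫ r = 𝟙 X) (h : IsIso (τ.app Y)) : IsIso (τ.app X) := by
  refine ⟨K.map i ≫ inv (τ.app Y) ≫ H.map r, ?_, ?_⟩
  · rw [← Category.assoc, ← τ.naturality, Category.assoc, IsIso.hom_inv_id_assoc, ← H.map_comp, w,
      H.map_id]
  · rw [Category.assoc, Category.assoc, τ.naturality, IsIso.inv_hom_id_assoc, ← K.map_comp, w,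
      K.map_id]

theorem nak_isNakayama [hT : Module.Finite A T] [IsNoetherianRing A] [IsArtinianRing A]
    (hinj : Module.Injective A T)
    (hsep : ∀ (M : Type u) [AddCommGroup M] [Module A M] (x : M), x ≠ 0 →
        ∃ g : M →ₗ[A] T, g x ≠ 0) (adj : F ⊣ nakG ρ) : IsNakayama adj := by
  have hp : ∀ P : ModuleCat.{u} A, Module.Projective A P →
      ∃ (ι : Type u) (i : P ⟶ ModuleCat.of A (ι →₀ A)) (r : ModuleCat.of A (ι →₀ A) ⟶ P),
        i ≫ r = 𝟙 P := by
    intro P hP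
    obtain ⟨s, hs⟩ := hP.out
    exact ⟨P, ModuleCat.ofHom s, ModuleCat.ofHom (Finsupp.linearCombination A id),
      ModuleCat.hom_ext (LinearMap.ext hs)⟩
  have hi : ∀ P : ModuleCat.{u} A, Module.Injective A P →
      ∃ (ι : Type u) (i : P ⟶ ModuleCat.of A (ι →₀ T)) (r : ModuleCat.of A (ι →₀ T) ⟶ P),
        i ≫ r = 𝟙 P := by
    intro P hP
    obtain ⟨ι, j, hj⟩ := exists_emb_finsupp hinj hsep P
    obtain ⟨r, hr⟩ := hP.out j hj LinearMap.id
    exact ⟨ι, ModuleCat.ofHom j, ModuleCat.ofHom r, ModuleCat.hom_ext (LinearMap.ext hr)⟩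
  have hcT : ∀ ι : Type u, IsIso (adj.counit.app (ModuleCat.of A (ι →₀ T))) := by
    intro ι
    obtain ⟨θ, -⟩ := nak_iso adj ι
    refine isIso_app_of_iso adj.counit θ.symm ?_
    have h1 := nak_unit_free adj ι
    have h2 := adj.left_triangle_components (ModuleCat.of A (ι →₀ A))
    have h3 : IsIso (F.map (adj.unit.app (ModuleCat.of A (ι →₀ A)))) := inferInstance
    exact IsIso.of_isIso_fac_left h2
  refine ⟨?_, ?_, ?_, ?_⟩
  · intro P hP
    obtain ⟨ι, i, r, w⟩ := hp P hP
    obtain ⟨θ, -⟩ := nak_iso adj ι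
    have h1 := (Module.injective_iff_injective_object A _).1 (finsupp_inj hinj ι)
    rw [Module.injective_iff_injective_object]
    have : Retract (F.obj P) (ModuleCat.of A (ι →₀ T)) :=
      ⟨F.map i ≫ θ.hom, θ.inv ≫ F.map r, by
        rw [Category.assoc, θ.hom_inv_id_assoc, ← F.map_comp, w, F.map_id]⟩
    exact this.injective
  · intro I hI
    obtain ⟨ι, i, r, w⟩ := hi I hI
    obtain ⟨θ, -⟩ := nak_iso adj ι
    have h1 := nak_unit_free adj ι
    let e := asIso (adj.unit.app (ModuleCat.of A (ι →₀ A))) ≪≫ (nakG ρ).mapIso θ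
    refine Module.Projective.of_split ((nakG ρ).map i ≫ e.inv).hom (e.hom ≫ (nakG ρ).map r).hom ?_
    rw [← ModuleCat.hom_comp, Category.assoc, e.inv_hom_id_assoc, ← Functor.map_comp, w]
    rw [CategoryTheory.Functor.map_id]
    rfl
  · intro P hP
    obtain ⟨ι, i, r, w⟩ := hp P hP
    exact retract_iso adj.unit i r w (nak_unit_free adj ι)
  · intro I hI
    obtain ⟨ι, i, r, w⟩ := hi I hI
    exact retract_iso adj.counit i r w (hcT ι)

end P8

/-- If `A` is an Artin algebra such that the only localizing
subcategory of `D_GI(A)` containing all Gorenstein-injective modules is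
`D_GI(A)` itself, then every bounded below GP-acyclic complex of
Gorenstein-projective modules is contractible. -/
theorem contractible_of_GI_generation
    (k : Type u) [CommRing k] [IsArtinianRing k]
    [Algebra k A] [Module.Finite k A]
    (hgen : ∀ S : Set (DGI A), IsLocalizingSubcategory A S →
      (∀ M : ModuleCat.{u} A, IsGorensteinInjective A M → singleDGI A M ∈ S) →
      S = Set.univ)
    (X : Cplx A) (hb : BoundedBelow A X) (hacyc : GPAcyclic A X)
    (hterms : ∀ n : ℤ, IsGorensteinProjective A (X.X n)) :
    Contractible A X := by
  obtain ⟨T, h1, h2, h3, ⟨ρ⟩, h4, h5⟩ := exists_nakT k A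
  obtain ⟨F, ⟨adj⟩⟩ := exists_nakF ρ
  have hF : F.Additive := adj.left_adjoint_additive
  exact main_of_nakayama (nak_isNakayama h2 h3 adj) hgen X hb hacyc hterms
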